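/- For every ρ* > 0 there exists a constant C > 0 depending only on ρ* such that for every integer N ≥ 2 with ε = 1/N and every (i', j') ∈ F_N° = F_N \ {(0,0)}: the matrices B_D[i', j'] and B_C[i', j'] are invertible and ‖ B_D[i', j']⁻¹ − B_C[i', j']⁻¹ ‖ ≤ C·ε², where ‖·‖ is the spectral (operator) norm on 2×2 real matrices. -/

import Mathlib

noncomputable section
open Real Matrix Finset

/-- counterclockwise rotation by π/2 -/
def perp (l : Fin 2 → ℝ) : Fin 2 → ℝ := ![-(l 1), l 0]

/-- triangular-lattice direction l₁ = (1/2, −√3/2) -/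
def tl1 : Fin 2 → ℝ := ![1/2, -(Real.sqrt 3)/2]
/-- triangular-lattice direction l₂ = (1, 0) -/
def tl2 : Fin 2 → ℝ := ![1, 0]
/-- triangular-lattice direction l₃ = (1/2, √3/2) -/
def tl3 : Fin 2 → ℝ := ![1/2, Real.sqrt 3 / 2]

/-- ε = 1/N -/
def eps (N : ℕ) : ℝ := 1 / N

/-- (i, j) belongs to the frequency set F_N, i.e. −N/2 ≤ i < N/2 and −N/2 ≤ j < N/2 -/
def inFreq (N : ℕ) (i j : ℤ) : Prop :=
  -(N:ℤ) ≤ 2*i ∧ 2*i < (N:ℤ) ∧ -(N:ℤ) ≤ 2*j ∧ 2*j < (N:ℤ)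

/-- the block ρ l lᵀ + 12 l⊥ l⊥ᵀ -/
def blk (ρ : ℝ) (l : Fin 2 → ℝ) : Matrix (Fin 2) (Fin 2) ℝ :=
  ρ • vecMulVec l l + (12:ℝ) • vecMulVec (perp l) (perp l)

/-- the discrete matrix A_D[i', j'] -/
def AD (ρ : ℝ) (N : ℕ) (i j : ℤ) : Matrix (Fin 2) (Fin 2) ℝ :=
  (4 * Real.sin (π * i * eps N)^2 / (eps N)^2) • blk ρ tl1
  + (4 * Real.sin (π * (i+j) * eps N)^2 / (eps N)^2) • blk ρ tl2
  + (4 * Real.sin (π * j * eps N)^2 / (eps N)^2) • blk ρ tl3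

/-- the discrete vector d_D[i', j'] -/
def dD (N : ℕ) (i j : ℤ) : Fin 2 → ℝ :=
  (12:ℝ) • ((Real.sin (2*π*i*eps N) / eps N) • perp tl1
    + (Real.sin (2*π*(i+j)*eps N) / eps N) • perp tl2
    + (Real.sin (2*π*j*eps N) / eps N) • perp tl3)

/-- the discrete scalar c_D[i', j'] -/
def cD (N : ℕ) (i j : ℤ) : ℝ :=
  36 - 8 * (Real.sin (π * i * eps N)^2 + Real.sin (π * (i+j) * eps N)^2
    + Real.sin (π * j * eps N)^2)

/-- the discrete Schur complement B_D[i', j'] = A_D − (1/c_D) d_D d_Dᵀ -/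
def BD (ρ : ℝ) (N : ℕ) (i j : ℤ) : Matrix (Fin 2) (Fin 2) ℝ :=
  AD ρ N i j - (1 / cD N i j) • vecMulVec (dD N i j) (dD N i j)

/-- the continuum matrix A_C[i', j'] -/
def AC (ρ : ℝ) (i j : ℤ) : Matrix (Fin 2) (Fin 2) ℝ :=
  (4 * π^2 * (i:ℝ)^2) • blk ρ tl1 + (4 * π^2 * ((i:ℝ)+(j:ℝ))^2) • blk ρ tl2
  + (4 * π^2 * (j:ℝ)^2) • blk ρ tl3

/-- the continuum vector d_C[i', j'] -/
def dC (i j : ℤ) : Fin 2 → ℝ :=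
  (24 * π) • ((i:ℝ) • perp tl1 + ((i:ℝ)+(j:ℝ)) • perp tl2 + (j:ℝ) • perp tl3)

/-- the continuum Schur complement B_C[i', j'] = A_C − (1/36) d_C d_Cᵀ -/
def BC (ρ : ℝ) (i j : ℤ) : Matrix (Fin 2) (Fin 2) ℝ :=
  AC ρ i j - (1/36 : ℝ) • vecMulVec (dC i j) (dC i j)

/-- spectral (operator) norm of a 2×2 real matrix, i.e. the operator norm of
the induced map on Euclidean space -/
def specNorm (M : Matrix (Fin 2) (Fin 2) ℝ) : ℝ :=
  ‖Matrix.toEuclideanCLM (𝕜 := ℝ) M‖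

/-- quadratic form coercivity gives invertibility and a bound on the inverse -/
lemma coercive_inv (B : Matrix (Fin 2) (Fin 2) ℝ) (κ : ℝ) (hκ : 0 < κ)
    (h : ∀ a b : ℝ, κ * (a^2 + b^2) ≤
      a * (B 0 0 * a + B 0 1 * b) + b * (B 1 0 * a + B 1 1 * b)) :
    IsUnit B ∧ specNorm B⁻¹ ≤ 1 / κ := by
  have hu : IsUnit B := by
    rw [← Matrix.mulVec_injective_iff_isUnit]
    intro v w hvw
    have h0 : B *ᵥ (v - w) = 0 := by
      rw [Matrix.mulVec_sub]; exact sub_eq_zero.2 hvw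
    have e0 := congrFun h0 0
    have e1 := congrFun h0 1
    simp only [Matrix.mulVec, dotProduct, Fin.sum_univ_two, Pi.sub_apply, Pi.zero_apply] at e0 e1
    have := h (v 0 - w 0) (v 1 - w 1)
    rw [e0, e1] at this
    have h2 : (v 0 - w 0)^2 + (v 1 - w 1)^2 ≤ 0 := by
      by_contra hc
      push Not at hc
      have := mul_pos hκ hc
      linarith
    have a0 : v 0 - w 0 = 0 := by nlinarith [sq_nonneg (v 0 - w 0), sq_nonneg (v 1 - w 1)]
    have a1 : v 1 - w 1 = 0 := by nlinarith [sq_nonneg (v 0 - w 0), sq_nonneg (v 1 - w 1)]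
    ext k
    fin_cases k
    · simpa using sub_eq_zero.1 a0
    · simpa using sub_eq_zero.1 a1
  refine ⟨hu, ?_⟩
  unfold specNorm
  refine ContinuousLinearMap.opNorm_le_bound _ (by positivity) ?_
  intro x
  set v := Matrix.toEuclideanCLM (𝕜 := ℝ) B⁻¹ x with hv
  have hx : Matrix.toEuclideanCLM (𝕜 := ℝ) B v = x := by
    rw [hv, ← ContinuousLinearMap.mul_apply, ← map_mul,
      Matrix.mul_nonsing_inv _ ((Matrix.isUnit_iff_isUnit_det _).1 hu), map_one]
    rfl
  have hx0 : x 0 = B 0 0 * v 0 + B 0 1 * v 1 := by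
    conv_lhs => rw [← hx]
    simp [Matrix.mulVec, dotProduct, Fin.sum_univ_two]
  have hx1 : x 1 = B 1 0 * v 0 + B 1 1 * v 1 := by
    conv_lhs => rw [← hx]
    simp [Matrix.mulVec, dotProduct, Fin.sum_univ_two]
  have h1 := h (v 0) (v 1)
  rw [← hx0, ← hx1] at h1
  have hn : ‖v‖^2 = v 0 ^2 + v 1 ^2 := by
    simp [EuclideanSpace.norm_sq_eq, Fin.sum_univ_two]
  have hi : v 0 * x 0 + v 1 * x 1 ≤ ‖v‖ * ‖x‖ := by
    have := real_inner_le_norm v x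
    simp only [PiLp.inner_apply, Fin.sum_univ_two, RCLike.inner_apply, conj_trivial] at this
    linarith
  rw [← hn] at h1
  rw [one_div, ← div_eq_inv_mul, le_div_iff₀ hκ]
  rcases (norm_nonneg v).eq_or_lt with h0 | h0
  · rw [← h0]; simp
  · have : ‖v‖ * (‖v‖ * κ) ≤ ‖v‖ * ‖x‖ := by nlinarith
    exact le_of_mul_le_mul_left this h0

lemma specNorm_entries (M : Matrix (Fin 2) (Fin 2) ℝ) (m : ℝ)
    (h : ∀ p q, |M p q| ≤ m) : specNorm M ≤ 2 * m := by
  have hm : 0 ≤ m := (abs_nonneg _).trans (h 0 0)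
  unfold specNorm
  refine ContinuousLinearMap.opNorm_le_bound _ (by positivity) ?_
  intro x
  have hn : ‖x‖^2 = x 0 ^2 + x 1 ^2 := by
    simp [EuclideanSpace.norm_sq_eq, Fin.sum_univ_two]
  have key : ∀ p : Fin 2, (M p 0 * x 0 + M p 1 * x 1)^2 ≤ 2 * m^2 * ‖x‖^2 := by
    intro p
    have a := sq_le_sq' (abs_le.1 (h p 0)).1 (abs_le.1 (h p 0)).2
    have b := sq_le_sq' (abs_le.1 (h p 1)).1 (abs_le.1 (h p 1)).2
    rw [hn]
    nlinarith [sq_nonneg (M p 0 * x 1 - M p 1 * x 0),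
      mul_le_mul_of_nonneg_right (add_le_add a b) (add_nonneg (sq_nonneg (x 0)) (sq_nonneg (x 1)))]
  have hy : ‖Matrix.toEuclideanCLM (𝕜 := ℝ) M x‖^2
      = (M 0 0 * x 0 + M 0 1 * x 1)^2 + (M 1 0 * x 0 + M 1 1 * x 1)^2 := by
    simp [EuclideanSpace.norm_sq_eq, Fin.sum_univ_two, Matrix.mulVec, dotProduct]
  refine (sq_le_sq₀ (norm_nonneg _) (by positivity)).1 ?_
  rw [hy]; nlinarith [key 0, key 1]

lemma specNorm_inv_sub (A B : Matrix (Fin 2) (Fin 2) ℝ) (hA : IsUnit A) (hB : IsUnit B) :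
    specNorm (A⁻¹ - B⁻¹) ≤ specNorm A⁻¹ * specNorm (B - A) * specNorm B⁻¹ := by
  have e : A⁻¹ - B⁻¹ = A⁻¹ * (B - A) * B⁻¹ := by
    rw [mul_sub, sub_mul, mul_assoc,
      Matrix.mul_nonsing_inv _ ((Matrix.isUnit_iff_isUnit_det _).1 hB),
      Matrix.nonsing_inv_mul _ ((Matrix.isUnit_iff_isUnit_det _).1 hA)]
    simp
  rw [e]
  unfold specNorm
  rw [map_mul, map_mul]
  exact (norm_mul_le _ _).trans (mul_le_mul_of_nonneg_right (norm_mul_le _ _) (norm_nonneg _))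

/-- common form of the discrete and continuum matrices -/
def GG (ρ a1 a2 a3 g1 g2 g3 h : ℝ) : Matrix (Fin 2) (Fin 2) ℝ :=
  a1 • blk ρ tl1 + a2 • blk ρ tl2 + a3 • blk ρ tl3
  - h • vecMulVec (g1 • perp tl1 + g2 • perp tl2 + g3 • perp tl3)
      (g1 • perp tl1 + g2 • perp tl2 + g3 • perp tl3)

lemma BD_eq (ρ : ℝ) (N : ℕ) (i j : ℤ) : BD ρ N i j =
    GG ρ (4 * Real.sin (π * i * eps N)^2 / (eps N)^2)
      (4 * Real.sin (π * (i+j) * eps N)^2 / (eps N)^2)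
      (4 * Real.sin (π * j * eps N)^2 / (eps N)^2)
      (12 * (Real.sin (2*π*i*eps N) / eps N))
      (12 * (Real.sin (2*π*(i+j)*eps N) / eps N))
      (12 * (Real.sin (2*π*j*eps N) / eps N)) (1 / cD N i j) := by
  simp only [BD, AD, dD, GG, smul_add, smul_smul]

lemma BC_eq (ρ : ℝ) (i j : ℤ) : BC ρ i j =
    GG ρ (4 * π^2 * (i:ℝ)^2) (4 * π^2 * ((i:ℝ)+(j:ℝ))^2) (4 * π^2 * (j:ℝ)^2)
      (24 * π * i) (24 * π * (i + j)) (24 * π * j) (1 / 36) := by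
  simp only [BC, AC, dC, GG, smul_add, smul_smul]

lemma form_lower (A1 A2 A3 a b : ℝ) (h1 : 0 ≤ A1) (h2 : 0 ≤ A2) (h3 : 0 ≤ A3)
    (H : 0 ≤ 4 * A1 * A3 - (A2 - A1 - A3)^2) (t : ℝ) (ht : t^2 = 3) :
    3/16 * (A1 + A2 + A3) * (a^2 + b^2) ≤
      A1 * (a/2 - t/2*b)^2 + A2 * a^2 + A3 * (a/2 + t/2*b)^2 := by
  set S := A1 + A2 + A3 with hS
  have hS0 : 0 ≤ S := by positivity
  rcases hS0.eq_or_lt with h0 | h0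
  · rw [← h0]; simp only [mul_zero, zero_mul]; positivity
  · have hdet : 3/16 * S^2 ≤ 3/4 * (A1*A2 + A1*A3 + A2*A3) := by rw [hS]; nlinarith
    have id : S * (A1 * (a/2 - t/2*b)^2 + A2 * a^2 + A3 * (a/2 + t/2*b)^2)
        = 3/4 * (A1*A2 + A1*A3 + A2*A3) * (a^2 + b^2)
          + ((A1/4+A2+A3/4)*a + (t/4*(A3-A1))*b)^2
          + ((t/4*(A3-A1))*a + (3/4*(A1+A3))*b)^2 := by
      rw [hS]
      linear_combination ((A1+A2+A3)*(A1*b^2/4+A3*b^2/4) - (A3-A1)^2/16*b^2 - (A3-A1)^2/16*a^2)*ht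
    have := mul_le_mul_of_nonneg_right hdet (add_nonneg (sq_nonneg a) (sq_nonneg b))
    refine le_of_mul_le_mul_left (?_ : S * _ ≤ S * _) h0
    rw [id]
    nlinarith [sq_nonneg ((A1/4+A2+A3/4)*a + (t/4*(A3-A1))*b),
      sq_nonneg ((t/4*(A3-A1))*a + (3/4*(A1+A3))*b)]

lemma cauchy3 (u1 u2 u3 e1 e2 e3 p1 p2 p3 h : ℝ) (hh : 0 ≤ h)
    (he : 12 * h * (e1^2 + e2^2 + e3^2) ≤ 1) :
    h * (24*u1*e1*p1 + 24*u2*e2*p2 + 24*u3*e3*p3)^2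
      ≤ 48 * (u1^2*p1^2 + u2^2*p2^2 + u3^2*p3^2) := by
  have cs : (e1*(u1*p1) + e2*(u2*p2) + e3*(u3*p3))^2
      ≤ (e1^2+e2^2+e3^2) * (u1^2*p1^2 + u2^2*p2^2 + u3^2*p3^2) := by
    nlinarith [sq_nonneg (e1*(u2*p2) - e2*(u1*p1)), sq_nonneg (e1*(u3*p3) - e3*(u1*p1)),
      sq_nonneg (e2*(u3*p3) - e3*(u2*p2))]
  have hP : 0 ≤ u1^2*p1^2 + u2^2*p2^2 + u3^2*p3^2 := by positivity
  have k1 := mul_le_mul_of_nonneg_left cs hh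
  have k2 := mul_le_mul_of_nonneg_right he hP
  nlinarith

lemma GG_coercive (ρ u1 u2 u3 e1 e2 e3 h : ℝ) (hρ : 0 < ρ) (hh : 0 ≤ h)
    (he : 12 * h * (e1^2 + e2^2 + e3^2) ≤ 1)
    (H : 0 ≤ 4 * u1^2 * u3^2 - (u2^2 - u1^2 - u3^2)^2) (a b : ℝ) :
    let B := GG ρ (4*u1^2) (4*u2^2) (4*u3^2) (24*u1*e1) (24*u2*e2) (24*u3*e3) h
    3/4 * ρ * (u1^2 + u2^2 + u3^2) * (a^2 + b^2) ≤
      a * (B 0 0 * a + B 0 1 * b) + b * (B 1 0 * a + B 1 1 * b) := by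
  intro B
  set t := Real.sqrt 3 with htd
  have ht : t^2 = 3 := by rw [htd]; norm_num
  have F := form_lower (u1^2) (u2^2) (u3^2) a b (by positivity) (by positivity) (by positivity) H t ht
  have G := cauchy3 u1 u2 u3 e1 e2 e3 (t/2*a + b/2) b (-(t/2)*a + b/2) h hh he
  have F' := mul_le_mul_of_nonneg_left F (by positivity : 0 ≤ 4 * ρ)
  have id : a * (B 0 0 * a + B 0 1 * b) + b * (B 1 0 * a + B 1 1 * b)
      = 4 * ρ * (u1^2 * (a/2 - t/2*b)^2 + u2^2 * a^2 + u3^2 * (a/2 + t/2*b)^2)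
       + 48 * (u1^2*(t/2*a + b/2)^2 + u2^2*b^2 + u3^2*(-(t/2)*a + b/2)^2)
       - h * (24*u1*e1*(t/2*a + b/2) + 24*u2*e2*b + 24*u3*e3*(-(t/2)*a + b/2))^2 := by
    simp [B, GG, blk, perp, tl1, tl2, tl3, vecMulVec_apply, ← htd]
    ring
  rw [id]
  linarith

lemma abs_entry (P Q x m : ℝ) (hP : |P| ≤ Q) (hx : |x| ≤ m) : |x * P| ≤ m * Q := by
  rw [abs_mul]
  exact mul_le_mul hx hP (abs_nonneg _) ((abs_nonneg _).trans hx)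

lemma perp_bounds (p : Fin 2) : |perp tl1 p| ≤ 1 ∧ |perp tl2 p| ≤ 1 ∧ |perp tl3 p| ≤ 1 ∧
    |tl1 p| ≤ 1 ∧ |tl2 p| ≤ 1 ∧ |tl3 p| ≤ 1 := by
  have h1 : 0 ≤ Real.sqrt 3 := Real.sqrt_nonneg _
  have h2 : Real.sqrt 3 ≤ 2 := by
    rw [Real.sqrt_le_left (by norm_num)]; norm_num
  fin_cases p <;> simp [perp, tl1, tl2, tl3, abs_le] <;> (repeat' constructor) <;> linarith

lemma blk_bound (ρ : ℝ) (hρ : 0 < ρ) (l : Fin 2 → ℝ) (h : ∀ p, |l p| ≤ 1)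
    (h' : ∀ p, |perp l p| ≤ 1) (p q : Fin 2) : |blk ρ l p q| ≤ ρ + 12 := by
  have a1 := abs_entry (l p) 1 (l q) 1 (h p) (h q)
  have a2 := abs_entry (perp l p) 1 (perp l q) 1 (h' p) (h' q)
  have e : blk ρ l p q = ρ * (l q * l p) + 12 * (perp l q * perp l p) := by
    simp [blk, vecMulVec_apply]; ring
  rw [e]
  rw [abs_le] at *
  constructor <;> nlinarith

lemma GG_diff (ρ a1 a2 a3 g1 g2 g3 h a1' a2' a3' g1' g2' g3' h' m n : ℝ) (hρ : 0 < ρ)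
    (A1 : |a1' - a1| ≤ m) (A2 : |a2' - a2| ≤ m) (A3 : |a3' - a3| ≤ m)
    (G11 : |h' * g1' * g1' - h * g1 * g1| ≤ n) (G12 : |h' * g1' * g2' - h * g1 * g2| ≤ n)
    (G13 : |h' * g1' * g3' - h * g1 * g3| ≤ n) (G22 : |h' * g2' * g2' - h * g2 * g2| ≤ n)
    (G23 : |h' * g2' * g3' - h * g2 * g3| ≤ n) (G33 : |h' * g3' * g3' - h * g3 * g3| ≤ n)
    (p q : Fin 2) :
    |(GG ρ a1' a2' a3' g1' g2' g3' h' - GG ρ a1 a2 a3 g1 g2 g3 h) p q|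
      ≤ 3 * (m * (ρ + 12)) + 9 * n := by
  have b1 := abs_entry _ _ _ _ (blk_bound ρ hρ tl1 (fun p => (perp_bounds p).2.2.2.1)
    (fun p => (perp_bounds p).1) p q) A1
  have b2 := abs_entry _ _ _ _ (blk_bound ρ hρ tl2 (fun p => (perp_bounds p).2.2.2.2.1)
    (fun p => (perp_bounds p).2.1) p q) A2
  have b3 := abs_entry _ _ _ _ (blk_bound ρ hρ tl3 (fun p => (perp_bounds p).2.2.2.2.2)
    (fun p => (perp_bounds p).2.2.1) p q) A3
  obtain ⟨p1, p2, p3, -⟩ := perp_bounds p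
  obtain ⟨q1, q2, q3, -⟩ := perp_bounds q
  have c11 := abs_entry _ _ _ _ (abs_entry _ _ _ _ p1 q1) G11
  have c12 := abs_entry _ _ _ _ (abs_entry _ _ _ _ p1 q2) G12
  have c21 := abs_entry _ _ _ _ (abs_entry _ _ _ _ p2 q1) G12
  have c13 := abs_entry _ _ _ _ (abs_entry _ _ _ _ p1 q3) G13
  have c31 := abs_entry _ _ _ _ (abs_entry _ _ _ _ p3 q1) G13
  have c22 := abs_entry _ _ _ _ (abs_entry _ _ _ _ p2 q2) G22
  have c23 := abs_entry _ _ _ _ (abs_entry _ _ _ _ p2 q3) G23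
  have c32 := abs_entry _ _ _ _ (abs_entry _ _ _ _ p3 q2) G23
  have c33 := abs_entry _ _ _ _ (abs_entry _ _ _ _ p3 q3) G33
  have e : (GG ρ a1' a2' a3' g1' g2' g3' h' - GG ρ a1 a2 a3 g1 g2 g3 h) p q
     = (a1' - a1) * blk ρ tl1 p q + (a2' - a2) * blk ρ tl2 p q + (a3' - a3) * blk ρ tl3 p q
      - ((h' * g1' * g1' - h * g1 * g1) * (perp tl1 q * perp tl1 p)
       + (h' * g1' * g2' - h * g1 * g2) * (perp tl2 q * perp tl1 p)
       + (h' * g1' * g2' - h * g1 * g2) * (perp tl1 q * perp tl2 p)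
       + (h' * g1' * g3' - h * g1 * g3) * (perp tl3 q * perp tl1 p)
       + (h' * g1' * g3' - h * g1 * g3) * (perp tl1 q * perp tl3 p)
       + (h' * g2' * g2' - h * g2 * g2) * (perp tl2 q * perp tl2 p)
       + (h' * g2' * g3' - h * g2 * g3) * (perp tl3 q * perp tl2 p)
       + (h' * g2' * g3' - h * g2 * g3) * (perp tl2 q * perp tl3 p)
       + (h' * g3' * g3' - h * g3 * g3) * (perp tl3 q * perp tl3 p)) := by
    simp only [GG, Matrix.sub_apply, Matrix.add_apply, Matrix.smul_apply, vecMulVec_apply,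
      Pi.add_apply, Pi.smul_apply, smul_eq_mul]
    ring
  rw [e]
  rw [abs_le] at *
  constructor <;> linarith

lemma sin_sub_bound (θ : ℝ) : |θ - Real.sin θ| ≤ 2 * |θ|^3 := by
  have pos : ∀ x : ℝ, 0 < x → |x - Real.sin x| ≤ 2 * x^3 := by
    intro x hx
    have h1 := Real.sin_lt hx
    rw [abs_of_pos (by linarith)]
    rcases le_total x 1 with h | h
    · have := Real.sin_gt_sub_cube hx
      have : 0 < x^3 := by positivity
      linarith
    · have := Real.neg_one_le_sin x
      nlinarith [pow_le_pow_right₀ h (show 1 ≤ 3 by norm_num)]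
  rcases lt_trichotomy θ 0 with h | h | h
  · have := pos (-θ) (by linarith)
    rw [abs_of_neg h]
    rw [Real.sin_neg] at this
    rw [abs_sub_comm]
    convert this using 2
    ring
  · simp [h]
  · rw [abs_of_pos h]; exact pos θ h

lemma sin_sq_bound (θ : ℝ) : |θ^2 - Real.sin θ^2| ≤ 4 * |θ|^4 := by
  have h1 := sin_sub_bound θ
  have h2 : |θ + Real.sin θ| ≤ 2 * |θ| := by
    have := abs_add_le θ (Real.sin θ)
    have := Real.abs_sin_le_abs (x := θ)
    linarith
  rw [sq_sub_sq, abs_mul]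
  calc _ ≤ (2 * |θ|) * (2 * |θ|^3) := mul_le_mul h2 h1 (abs_nonneg _) (by positivity)
    _ = _ := by ring

lemma prod_diff (h h' g1 g2 g1' g2' n k d : ℝ)
    (hh : |h' - h| ≤ n) (h1 : |h'| ≤ 1) (k1 : |g1'| ≤ k) (k1' : |g1| ≤ k)
    (k2' : |g2| ≤ k) (d1 : |g1' - g1| ≤ d) (d2 : |g2' - g2| ≤ d) :
    |h' * g1' * g2' - h * g1 * g2| ≤ n * k * k + 2 * (d * k) := by
  have e : h' * g1' * g2' - h * g1 * g2
     = (h' - h) * g1 * g2 + (g1' - g1) * g2 * h' + (g2' - g2) * g1' * h' := by ring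
  have x1 := abs_entry _ _ _ _ k2' (abs_entry _ _ _ _ k1' hh)
  have x2 := abs_entry _ _ _ _ h1 (abs_entry _ _ _ _ k2' d1)
  have x3 := abs_entry _ _ _ _ h1 (abs_entry _ _ _ _ k1 d2)
  rw [e]
  refine (abs_add_le _ _).trans ?_
  refine (add_le_add (abs_add_le _ _) le_rfl).trans ?_
  linarith

/-- a single-frequency comparison of the coefficients -/
lemma coef_bounds (n R e : ℝ) (he : 0 < e) (hn : |n| ≤ R) :
    |4 * π^2 * n^2 - 4 * Real.sin (π * n * e)^2 / e^2| ≤ 16 * (π^4 * e^2 * R^4) ∧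
    |24 * π * n| ≤ 24 * π * R ∧
    |12 * (Real.sin (2*π*n*e) / e)| ≤ 24 * π * R ∧
    |24 * π * n - 12 * (Real.sin (2*π*n*e) / e)| ≤ 192 * π^3 * e^2 * R^3 ∧
    Real.sin (π * n * e)^2 ≤ π^2 * e^2 * R^2 := by
  have hp := Real.pi_pos
  have hR : 0 ≤ R := (abs_nonneg _).trans hn
  have habs : ∀ c : ℝ, 0 ≤ c → |c * n * e| ≤ c * R * e := by
    intro c hc
    rw [abs_mul, abs_mul, abs_of_pos he, abs_of_nonneg hc]
    gcongr
  have t1 := habs π hp.le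
  have t2 := habs (2*π) (by positivity)
  refine ⟨?_, ?_, ?_, ?_, ?_⟩
  · have h := sin_sq_bound (π * n * e)
    have h4 : |π * n * e|^4 ≤ (π * R * e)^4 := by gcongr
    have eq : 4 * π^2 * n^2 - 4 * Real.sin (π * n * e)^2 / e^2
       = ((π * n * e)^2 - Real.sin (π * n * e)^2) * (4 / e^2) := by field_simp
    rw [eq, abs_mul, abs_of_pos (by positivity : 0 < 4 / e^2)]
    calc _ ≤ (4 * (π * R * e)^4) * (4 / e^2) := by gcongr; linarith
      _ = _ := by field_simp; ring
  · rw [abs_mul, abs_of_pos (by positivity)]; gcongr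
  · have h := (Real.abs_sin_le_abs (x := 2*π*n*e)).trans t2
    rw [abs_mul, abs_div, abs_of_pos he, abs_of_pos (by norm_num : (0:ℝ) < 12)]
    calc _ ≤ 12 * (2 * π * R * e / e) := by gcongr
      _ = _ := by field_simp; ring
  · have h := sin_sub_bound (2 * π * n * e)
    have h3 : |2 * π * n * e|^3 ≤ (2 * π * R * e)^3 := by gcongr
    have eq : 24 * π * n - 12 * (Real.sin (2*π*n*e) / e)
       = (2 * π * n * e - Real.sin (2 * π * n * e)) * (12 / e) := by field_simp; ring
    rw [eq, abs_mul, abs_of_pos (by positivity : 0 < 12 / e)]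
    calc _ ≤ (2 * (2 * π * R * e)^3) * (12 / e) := by gcongr; linarith
      _ = _ := by field_simp; ring
  · have h := (Real.abs_sin_le_abs (x := π*n*e)).trans t1
    rw [← sq_abs]
    calc _ ≤ (π * R * e)^2 := by gcongr
      _ = _ := by ring

lemma sin_lower (i e : ℝ) (he : 0 < e) (h1 : -1 ≤ 2 * (i * e)) (h2 : 2 * (i * e) ≤ 1) :
    4 * i^2 ≤ (Real.sin (π * i * e) / e)^2 := by
  have hp := Real.pi_pos
  have hx : |π * i * e| ≤ π / 2 := by
    rw [abs_le]; constructor <;> nlinarith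
  have := Real.mul_abs_le_abs_sin hx
  have h3 : (2 / π * |π * i * e|)^2 ≤ |Real.sin (π * i * e)|^2 := by gcongr
  rw [sq_abs, mul_pow, sq_abs] at h3
  rw [div_pow, le_div_iff₀ (by positivity)]
  refine le_trans (le_of_eq ?_) h3
  field_simp
  ring

lemma heron_sin (x y : ℝ) :
    0 ≤ 4 * Real.sin x^2 * Real.sin y^2
      - (Real.sin (x+y)^2 - Real.sin x^2 - Real.sin y^2)^2 := by
  have e : 4 * Real.sin x^2 * Real.sin y^2
      - (Real.sin (x+y)^2 - Real.sin x^2 - Real.sin y^2)^2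
      = (2 * Real.sin x * Real.sin y * Real.sin (x+y))^2 := by
    have h1 : Real.sin (x+y)^2 - Real.sin x^2 - Real.sin y^2
       = 2 * Real.sin x * Real.sin y * Real.cos (x+y) := by
      rw [Real.sin_add, Real.cos_add]
      have hx := Real.sin_sq_add_cos_sq x
      have hy := Real.sin_sq_add_cos_sq y
      linear_combination Real.sin x^2 * hy + Real.sin y^2 * hx
    rw [h1]
    have := Real.sin_sq_add_cos_sq (x+y)
    linear_combination (-4 * Real.sin x^2 * Real.sin y^2) * this
  rw [e]; positivity

lemma cD_ge (N : ℕ) (i j : ℤ) : 12 ≤ cD N i j := by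
  unfold cD
  have := Real.sin_sq_le_one (π * i * eps N)
  have := Real.sin_sq_le_one (π * (i+j) * eps N)
  have := Real.sin_sq_le_one (π * j * eps N)
  linarith

lemma BD_coercive (ρ : ℝ) (hρ : 0 < ρ) (N : ℕ) (hN : 2 ≤ N) (i j : ℤ) (hf : inFreq N i j)
    (a b : ℝ) : 3 * ρ * ((i:ℝ)^2 + (j:ℝ)^2) * (a^2 + b^2) ≤
      a * (BD ρ N i j 0 0 * a + BD ρ N i j 0 1 * b)
      + b * (BD ρ N i j 1 0 * a + BD ρ N i j 1 1 * b) := by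
  have hN0 : (0:ℝ) < N := by exact_mod_cast (by omega : 0 < N)
  have he : 0 < eps N := by unfold eps; positivity
  have heN : (N:ℝ) * eps N = 1 := by unfold eps; field_simp
  have hc := cD_ge N i j
  obtain ⟨f1, f2, f3, f4⟩ := hf
  have f1' : -(N:ℝ) ≤ 2 * i := by exact_mod_cast f1
  have f2' : 2 * (i:ℝ) ≤ N := by exact_mod_cast f2.le
  have f3' : -(N:ℝ) ≤ 2 * j := by exact_mod_cast f3
  have f4' : 2 * (j:ℝ) ≤ N := by exact_mod_cast f4.le
  have l1 := sin_lower i (eps N) he (by nlinarith) (by nlinarith)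
  have l3 := sin_lower j (eps N) he (by nlinarith) (by nlinarith)
  have key := GG_coercive ρ (Real.sin (π * i * eps N) / eps N)
    (Real.sin (π * (i+j) * eps N) / eps N) (Real.sin (π * j * eps N) / eps N)
    (Real.cos (π * i * eps N)) (Real.cos (π * (i+j) * eps N)) (Real.cos (π * j * eps N))
    (1 / cD N i j) hρ (by positivity) (by
      have s1 := Real.sin_sq_add_cos_sq (π * i * eps N)
      have s2 := Real.sin_sq_add_cos_sq (π * (i+j) * eps N)
      have s3 := Real.sin_sq_add_cos_sq (π * j * eps N)
      rw [mul_one_div, div_mul_eq_mul_div, div_le_one (by linarith)]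
      unfold cD
      nlinarith [sq_nonneg (Real.sin (π * i * eps N)), sq_nonneg (Real.sin (π * (i+j) * eps N)),
        sq_nonneg (Real.sin (π * j * eps N))]) (by
      have := heron_sin (π * i * eps N) (π * j * eps N)
      rw [show π * i * eps N + π * j * eps N = π * (i+j) * eps N by ring] at this
      have := mul_nonneg this (by positivity : 0 ≤ 1 / (eps N)^4)
      refine le_of_le_of_eq this ?_
      field_simp) a b
  have eq : BD ρ N i j = GG ρ (4 * (Real.sin (π * i * eps N) / eps N)^2)
    (4 * (Real.sin (π * (i+j) * eps N) / eps N)^2) (4 * (Real.sin (π * j * eps N) / eps N)^2)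
    (24 * (Real.sin (π * i * eps N) / eps N) * Real.cos (π * i * eps N))
    (24 * (Real.sin (π * (i+j) * eps N) / eps N) * Real.cos (π * (i+j) * eps N))
    (24 * (Real.sin (π * j * eps N) / eps N) * Real.cos (π * j * eps N)) (1 / cD N i j) := by
    rw [BD_eq]
    have d : ∀ z : ℝ, 12 * (Real.sin (2*π*z*eps N) / eps N)
       = 24 * (Real.sin (π * z * eps N) / eps N) * Real.cos (π * z * eps N) := by
      intro z
      rw [show 2*π*z*eps N = 2 * (π*z*eps N) by ring, Real.sin_two_mul]; ring
    rw [d, d, d]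
    congr 1 <;> ring
  rw [← eq] at key
  refine le_trans ?_ key
  apply mul_le_mul_of_nonneg_right _ (by positivity)
  have : 0 ≤ (Real.sin (π * (i+j) * eps N) / eps N)^2 := by positivity
  nlinarith

lemma BC_coercive (ρ : ℝ) (hρ : 0 < ρ) (i j : ℤ)
    (a b : ℝ) : 3 * ρ * ((i:ℝ)^2 + (j:ℝ)^2) * (a^2 + b^2) ≤
      a * (BC ρ i j 0 0 * a + BC ρ i j 0 1 * b)
      + b * (BC ρ i j 1 0 * a + BC ρ i j 1 1 * b) := by
  have key := GG_coercive ρ (π * i) (π * (i+j)) (π * j) 1 1 1 (1/36) hρ (by norm_num)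
    (by norm_num) (le_of_eq (by ring)) a b
  have eq : BC ρ i j = GG ρ (4 * (π * i)^2) (4 * (π * (i+j))^2) (4 * (π * j)^2)
    (24 * (π * i) * 1) (24 * (π * (i+j)) * 1) (24 * (π * j) * 1) (1/36) := by
    rw [BC_eq]
    congr 1 <;> ring
  rw [← eq] at key
  refine le_trans ?_ key
  apply mul_le_mul_of_nonneg_right _ (by positivity)
  have hp : 4 ≤ π^2 := by nlinarith [Real.two_le_pi]
  have h1 : 4 * (i:ℝ)^2 ≤ (π * i)^2 := by rw [mul_pow]; gcongr
  have h3 : 4 * (j:ℝ)^2 ≤ (π * j)^2 := by rw [mul_pow]; gcongr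
  have : 0 ≤ (π * ((i:ℝ)+j))^2 := by positivity
  nlinarith

lemma diff_bound (ρ : ℝ) (hρ : 0 < ρ) (N : ℕ) (hN : 2 ≤ N) (i j : ℤ) (p q : Fin 2) :
    |(BC ρ i j - BD ρ N i j) p q| ≤
      (48 * (ρ + 12) + 9 * 9792) * (π^4 * (eps N)^2 * (|(i:ℝ)| + |(j:ℝ)|)^4) := by
  have hN0 : (0:ℝ) < N := by exact_mod_cast (by omega : 0 < N)
  have he : 0 < eps N := by unfold eps; positivity
  have hc := cD_ge N i j
  set R := |(i:ℝ)| + |(j:ℝ)| with hR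
  have hR0 : 0 ≤ R := by positivity
  obtain ⟨a1, b1, c1, d1, s1⟩ := coef_bounds i R (eps N) he (by rw [hR]; linarith [abs_nonneg (j:ℝ)])
  obtain ⟨a2, b2, c2, d2, s2⟩ := coef_bounds (i+j) R (eps N) he (abs_add_le _ _)
  obtain ⟨a3, b3, c3, d3, s3⟩ := coef_bounds j R (eps N) he (by rw [hR]; linarith [abs_nonneg (i:ℝ)])
  have hh : |1/36 - 1 / cD N i j| ≤ π^2 * (eps N)^2 * R^2 := by
    have e1 : 1/36 - 1 / cD N i j = -((36 - cD N i j) / (36 * cD N i j)) := by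
      have : cD N i j ≠ 0 := by positivity
      field_simp; ring
    have h0 : 0 ≤ 36 - cD N i j := by
      unfold cD
      have := sq_nonneg (Real.sin (π * i * eps N))
      have := sq_nonneg (Real.sin (π * (i+j) * eps N))
      have := sq_nonneg (Real.sin (π * j * eps N))
      linarith
    have h1 : 36 - cD N i j ≤ 24 * (π^2 * (eps N)^2 * R^2) := by
      unfold cD
      linarith
    rw [e1, abs_neg, abs_of_nonneg (by positivity), div_le_iff₀ (by positivity)]
    have : 0 ≤ π^2 * (eps N)^2 * R^2 := by positivity
    nlinarith
  have P := fun g1 g2 g1' g2' x1 x2 x3 x4 x5 => prod_diff (1 / cD N i j) (1/36) g1 g2 g1' g2'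
    _ (24 * π * R) (192 * π^3 * (eps N)^2 * R^3) hh (by rw [abs_of_pos] <;> norm_num) x1 x2 x3 x4 x5
  rw [BD_eq, BC_eq]
  refine (GG_diff ρ _ _ _ _ _ _ _ _ _ _ _ _ _ _ _ _ hρ a1 a2 a3 (P _ _ _ _ b1 c1 c1 d1 d1)
    (P _ _ _ _ b1 c1 c2 d1 d2) (P _ _ _ _ b1 c1 c3 d1 d3) (P _ _ _ _ b2 c2 c2 d2 d2)
    (P _ _ _ _ b2 c2 c3 d2 d3) (P _ _ _ _ b3 c3 c3 d3 d3) p q).trans (le_of_eq ?_)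
  ring

/-- for every ρ* > 0 there is C > 0 depending only on ρ* such that
for every N ≥ 2 (ε = 1/N) and every (i', j') ∈ F_N° = F_N \ {(0,0)}, the
matrices B_D[i',j'] and B_C[i',j'] are invertible and
‖B_D[i',j']⁻¹ − B_C[i',j']⁻¹‖ ≤ C ε² in spectral norm. -/
theorem inverse_difference (ρ : ℝ) (hρ : 0 < ρ) :
    ∃ C > 0, ∀ N : ℕ, 2 ≤ N → ∀ i j : ℤ, inFreq N i j → ¬(i = 0 ∧ j = 0) →
      IsUnit (BD ρ N i j) ∧ IsUnit (BC ρ i j) ∧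
      specNorm ((BD ρ N i j)⁻¹ - (BC ρ i j)⁻¹) ≤ C * (eps N)^2 := by
  refine ⟨8 * (48 * (ρ + 12) + 9 * 9792) * π^4 / (9 * ρ^2), by positivity, ?_⟩
  intro N hN i j hf hij
  have hk : 0 < (i:ℝ)^2 + (j:ℝ)^2 := by
    by_cases hi : i = 0
    · have hj : (j:ℝ) ≠ 0 := by exact_mod_cast fun h => hij ⟨hi, h⟩
      positivity
    · have hi' : (i:ℝ) ≠ 0 := by exact_mod_cast hi
      positivity
  set k := (i:ℝ)^2 + (j:ℝ)^2 with hkd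
  obtain ⟨uD, nD⟩ := coercive_inv _ (3 * ρ * k) (by positivity) (BD_coercive ρ hρ N hN i j hf)
  obtain ⟨uC, nC⟩ := coercive_inv _ (3 * ρ * k) (by positivity) (BC_coercive ρ hρ i j)
  refine ⟨uD, uC, ?_⟩
  have hd := specNorm_entries _ _ (diff_bound ρ hρ N hN i j)
  have hR2 : (|(i:ℝ)| + |(j:ℝ)|)^2 ≤ 2 * k := by
    rw [hkd]
    nlinarith [sq_nonneg (|(i:ℝ)| - |(j:ℝ)|), sq_abs (i:ℝ), sq_abs (j:ℝ)]
  have hR4 : (|(i:ℝ)| + |(j:ℝ)|)^4 ≤ 4 * k^2 := by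
    calc (|(i:ℝ)| + |(j:ℝ)|)^4 = ((|(i:ℝ)| + |(j:ℝ)|)^2)^2 := by ring
      _ ≤ (2 * k)^2 := by gcongr
      _ = _ := by ring
  have hd' : specNorm (BC ρ i j - BD ρ N i j) ≤
      2 * ((48 * (ρ + 12) + 9 * 9792) * (π^4 * (eps N)^2 * (4 * k^2))) := by
    refine hd.trans ?_
    gcongr
  have nn : ∀ M, 0 ≤ specNorm M := fun M => norm_nonneg _
  calc _ ≤ _ := specNorm_inv_sub _ _ uD uC
    _ ≤ (1 / (3 * ρ * k)) * (2 * ((48 * (ρ + 12) + 9 * 9792) * (π^4 * (eps N)^2 * (4 * k^2))))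
        * (1 / (3 * ρ * k)) := by
      refine mul_le_mul (mul_le_mul nD hd' (nn _) (by positivity)) nC (nn _) (by positivity)
    _ = _ := by field_simp; ring
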